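/- Let G be a groupoid, x an object of G, and let (f, g : y ⟶ x) and (f', g' : y' ⟶ x) be two parallel pairs of morphisms into x. Then there exists a morphism h : y ⟶ y' with f = h ≫ f' and g = h ≫ g' if and only if inv f ≫ g = inv f' ≫ g' as automorphisms of x. In particular, mutual factorization classes of parallel pairs into x are in bijection with the automorphism group Hom(x, x), with the class of (𝟙_x, 𝟙_x) corresponding to the identity. -/

import Mathlib

open CategoryTheory

/-- A parallel pair of morphisms into `x`: an object `y` together with two
morphisms `y ⟶ x`. -/
def ParPair {G : Type*} [Groupoid G] (x : G) : Type _ := Σ y : G, (y ⟶ x) × (y ⟶ x)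

/-- `p` factors through `q`: a morphism of parallel pairs from `p` to `q`. -/
def ParPairFactors {G : Type*} [Groupoid G] {x : G} (p q : ParPair x) : Prop :=
  ∃ h : p.1 ⟶ q.1, p.2.1 = h ≫ q.2.1 ∧ p.2.2 = h ≫ q.2.2

/-- Mutual factorization of parallel pairs into `x` is an equivalence relation. -/
def parPairSetoid {G : Type*} [Groupoid G] (x : G) : Setoid (ParPair x) where
  r p q := ParPairFactors p q ∧ ParPairFactors q p
  iseqv := by
    constructor
    · intro p
      exact ⟨⟨𝟙 _, by simp, by simp⟩, ⟨𝟙 _, by simp, by simp⟩⟩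
    · rintro p q ⟨a, b⟩
      exact ⟨b, a⟩
    · rintro p q r ⟨⟨h1, e1, e2⟩, ⟨k1, e3, e4⟩⟩ ⟨⟨h2, d1, d2⟩, ⟨k2, d3, d4⟩⟩
      exact ⟨⟨h1 ≫ h2, by simp [e1, d1], by simp [e2, d2]⟩,
             ⟨k2 ≫ k1, by simp [d3, e3], by simp [d4, e4]⟩⟩

theorem exists_parallel_factorization_iff {G : Type*} [Groupoid G] {x y y' : G}
    (f g : y ⟶ x) (f' g' : y' ⟶ x) :
    (∃ h : y ⟶ y', f = h ≫ f' ∧ g = h ≫ g') ↔ inv f ≫ g = inv f' ≫ g' := by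
  constructor
  · rintro ⟨h, rfl, rfl⟩
    simp
  · intro e
    exact ⟨f ≫ inv f', by simp, by simp [← e]⟩

theorem parPairSetoid_iff {G : Type*} [Groupoid G] {x : G} (p q : ParPair x) :
    parPairSetoid x p q ↔ inv p.2.1 ≫ p.2.2 = inv q.2.1 ≫ q.2.2 :=
  ⟨fun h => (exists_parallel_factorization_iff _ _ _ _).1 h.1,
    fun h => ⟨(exists_parallel_factorization_iff _ _ _ _).2 h,
      (exists_parallel_factorization_iff _ _ _ _).2 h.symm⟩⟩

/-- The class of a parallel pair `(u, v)` corresponds to the automorphism `inv u ≫ v`. -/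
noncomputable def parPairQuotientEquiv {G : Type*} [Groupoid G] (x : G) :
    Quotient (parPairSetoid x) ≃ (x ⟶ x) where
  toFun := Quotient.lift (fun p : ParPair x => inv p.2.1 ≫ p.2.2)
    fun p q h => (parPairSetoid_iff p q).1 h
  invFun a := Quotient.mk (parPairSetoid x) ⟨x, 𝟙 x, a⟩
  left_inv := by
    rintro ⟨p⟩
    exact Quotient.sound ((parPairSetoid_iff _ _).2 (by simp))
  right_inv a := show inv (𝟙 x) ≫ a = a by simp

/-- In a groupoid, a parallel pair `(f, g : y ⟶ x)` factors through `(f', g' : y' ⟶ x)`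
iff `inv f ≫ g = inv f' ≫ g'`; hence mutual factorization classes of parallel pairs
into `x` are in bijection with the automorphisms `x ⟶ x`, the class of `(𝟙 x, 𝟙 x)`
corresponding to the identity.  This recovers `π₁(G, x)` as a pointed set. -/
theorem groupoid_parallelPairs_give_pi1 {G : Type*} [Groupoid G] {x y y' : G}
    (f g : y ⟶ x) (f' g' : y' ⟶ x) :
    ((∃ h : y ⟶ y', f = h ≫ f' ∧ g = h ≫ g') ↔ inv f ≫ g = inv f' ≫ g') ∧
    Nonempty { e : Quotient (parPairSetoid x) ≃ (x ⟶ x) //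
      (∀ (z : G) (u v : z ⟶ x),
        e (Quotient.mk (parPairSetoid x) ⟨z, u, v⟩) = inv u ≫ v) ∧
      e (Quotient.mk (parPairSetoid x) ⟨x, 𝟙 x, 𝟙 x⟩) = 𝟙 x } :=
  ⟨exists_parallel_factorization_iff f g f' g',
    ⟨⟨parPairQuotientEquiv x, fun _ _ _ => rfl,
      show inv (𝟙 x) ≫ 𝟙 x = 𝟙 x by simp⟩⟩⟩
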